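/- arXiv:1710.09936 — 5 statements merged into one kernel-verified Lean document; each statement's English description precedes it below -/
import Mathlib

section
/- Let I ⊆ ℝ be an interval, let h : [0,∞) → [0,∞) be superadditive (h(s+t) ≥ h(s) + h(t) for all s,t ≥ 0), and let f : I → (0,∞) satisfy f(t·x + (1−t)·y) ≤ h(t)·f(x) + h(1−t)·f(y) for all x,y ∈ I and t ∈ [0,1]. Then for all x, y, z ∈ I: f((x+z)/2) + f((y+z)/2) + f((x+y)/2) ≤ h(3/2)·f((x+y+z)/3) + h(1/2)·(f(x) + f(y) + f(z)). -/
/-- If `a` and `b` lie on the same side of the mean `m` of `a, b, c`, then the midpoints of `a, c` and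
`b, c` are convex combinations of `m` and `c` whose weights at `m` add up to `3 / 2`. -/
theorem exists_midpoint_weights (a b c m : ℝ) (hm : a + b + c = 3 * m)
    (hab : 0 ≤ (m - a) * (m - b)) :
    ∃ s ∈ Set.Icc (0 : ℝ) 1, ∃ t ∈ Set.Icc (0 : ℝ) 1, s + t = 3 / 2 ∧
      s * m + (1 - s) * c = (a + c) / 2 ∧ t * m + (1 - t) * c = (b + c) / 2 := by
  obtain ⟨r, hr0, hr1, hr⟩ : ∃ r : ℝ, 0 ≤ r ∧ r ≤ 1 ∧ r * (c - m) = m - a := by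
    by_cases hc : c - m = 0
    · have ha : m - a = 0 := by
        have hb : m - b = -(m - a) := by linarith
        rw [hb] at hab
        nlinarith
      exact ⟨0, le_rfl, zero_le_one, by rw [ha, zero_mul]⟩
    · have hd : 0 < (c - m) ^ 2 := by positivity
      have hsum : c - m = (m - a) + (m - b) := by linarith
      refine ⟨(m - a) * (c - m) / (c - m) ^ 2, ?_, ?_, by field_simp⟩
      · refine div_nonneg ?_ hd.le
        rw [hsum]
        nlinarith [sq_nonneg (m - a)]
      · rw [div_le_one hd, hsum]
        nlinarith [sq_nonneg (m - b)]
  refine ⟨1 / 2 + r / 2, ⟨by linarith, by linarith⟩, 1 - r / 2, ⟨by linarith, by linarith⟩,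
    by ring, ?_, ?_⟩ <;> linarith

/-- Popoviciu-type inequality for points `a` and `b` on the same side of the mean of `a, b, c`. -/
theorem popoviciu_of_same_side {I : Set ℝ} (hI : Convex ℝ I) {h f : ℝ → ℝ}
    (hh_super : ∀ s, 0 ≤ s → ∀ t, 0 ≤ t → h s + h t ≤ h (s + t))
    (hf_pos : ∀ x ∈ I, 0 < f x)
    (hf : ∀ x ∈ I, ∀ y ∈ I, ∀ t ∈ Set.Icc (0 : ℝ) 1,
      f (t * x + (1 - t) * y) ≤ h t * f x + h (1 - t) * f y)
    {a b c m : ℝ} (ha : a ∈ I) (hb : b ∈ I) (hc : c ∈ I) (hm : a + b + c = 3 * m)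
    (hab : 0 ≤ (m - a) * (m - b)) :
    f ((a + c) / 2) + f ((b + c) / 2) + f ((a + b) / 2) ≤
      h (3 / 2) * f m + h (1 / 2) * (f a + f b + f c) := by
  have hmI : m ∈ I := by
    have hmid : (1 / 2 : ℝ) • a + (1 / 2 : ℝ) • b ∈ I :=
      hI ha hb (by norm_num) (by norm_num) (by norm_num)
    have hmean := hI hmid hc (show (0 : ℝ) ≤ 2 / 3 by norm_num)
      (show (0 : ℝ) ≤ 1 / 3 by norm_num) (by norm_num)
    convert hmean using 1
    simp only [smul_eq_mul]
    linarith
  obtain ⟨s, hs, t, ht, hst, hsa, htb⟩ := exists_midpoint_weights a b c m hm hab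
  have hfs := hf m hmI c hc s hs
  have hft := hf m hmI c hc t ht
  rw [hsa] at hfs
  rw [htb] at hft
  have hfab := hf a ha b hb (1 / 2) ⟨by norm_num, by norm_num⟩
  rw [show (1 / 2 : ℝ) * a + (1 - 1 / 2) * b = (a + b) / 2 by ring,
    show (1 - 1 / 2 : ℝ) = 1 / 2 by norm_num] at hfab
  have hhm := hh_super s hs.1 t ht.1
  rw [hst] at hhm
  have hhc := hh_super (1 - s) (sub_nonneg.2 hs.2) (1 - t) (sub_nonneg.2 ht.2)
  rw [show 1 - s + (1 - t) = 1 / 2 by linarith] at hhc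
  have hfm := mul_le_mul_of_nonneg_right hhm (hf_pos m hmI).le
  have hfc := mul_le_mul_of_nonneg_right hhc (hf_pos c hc).le
  linarith

/-- Popoviciu-type inequality for `A_tA_h`-convex functions with superadditive `h`. -/
theorem popoviciu_AA_h (I : Set ℝ) (hI : Convex ℝ I)
    (h : ℝ → ℝ) (hh_nonneg : ∀ s, 0 ≤ s → 0 ≤ h s)
    (hh_super : ∀ s, 0 ≤ s → ∀ t, 0 ≤ t → h s + h t ≤ h (s + t))
    (f : ℝ → ℝ) (hf_pos : ∀ x ∈ I, 0 < f x)
    (hf : ∀ x ∈ I, ∀ y ∈ I, ∀ t ∈ Set.Icc (0 : ℝ) 1,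
      f (t * x + (1 - t) * y) ≤ h t * f x + h (1 - t) * f y) :
    ∀ x ∈ I, ∀ y ∈ I, ∀ z ∈ I,
      f ((x + z) / 2) + f ((y + z) / 2) + f ((x + y) / 2) ≤
        h (3 / 2) * f ((x + y + z) / 3) + h (1 / 2) * (f x + f y + f z) := by
  intro x hx y hy z hz
  have hm : x + y + z = 3 * ((x + y + z) / 3) := by ring
  generalize (x + y + z) / 3 = m at hm ⊢
  by_cases hxy : 0 ≤ (m - x) * (m - y)
  · have := popoviciu_of_same_side hI hh_super hf_pos hf hx hy hz hm hxy
    linarith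
  by_cases hxz : 0 ≤ (m - x) * (m - z)
  · have := popoviciu_of_same_side hI hh_super hf_pos hf hx hz hy (by linarith) hxz
    rw [add_comm z y] at this
    linarith
  have hyz : 0 ≤ (m - y) * (m - z) := by
    by_contra! hyz
    push Not at hxy hxz
    rcases le_total 0 (m - x) with h1 | h1 <;> rcases le_total 0 (m - y) with h2 | h2 <;>
      rcases le_total 0 (m - z) with h3 | h3 <;> nlinarith
  have := popoviciu_of_same_side hI hh_super hf_pos hf hy hz hx (by linarith) hyz
  rw [add_comm y x, add_comm z x] at this
  linarith
end

section
/- Let I ⊆ ℝ be an interval and let f : I → (0,∞) satisfy f(t·x + (1−t)·y) ≤ t·f(x) + (1−t)·f(y) for all x,y ∈ I and t ∈ [0,1]. Then for all x, y, z ∈ I: (2/3)·(f((x+z)/2) + f((y+z)/2) + f((x+y)/2)) ≤ f((x+y+z)/3) + (f(x) + f(y) + f(z))/3. -/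
/-- Popoviciu's inequality when `x` and `y` lie on the same side of the mean of `x`, `y`, `z`. -/
theorem ConvexOn.popoviciu_of_same_side {I : Set ℝ} {f : ℝ → ℝ} (hf : ConvexOn ℝ I f)
    {x y z : ℝ} (hx : x ∈ I) (hy : y ∈ I) (hz : z ∈ I)
    (hxy : 0 ≤ (x - (x + y + z) / 3) * (y - (x + y + z) / 3)) :
    (2 / 3) * (f ((x + z) / 2) + f ((y + z) / 2) + f ((x + y) / 2)) ≤
      f ((x + y + z) / 3) + (f x + f y + f z) / 3 := by
  have hmid : f ((x + y) / 2) ≤ (f x + f y) / 2 := by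
    have h := hf.2 hx hy (by norm_num : (0 : ℝ) ≤ 1 / 2)
      (by norm_num : (0 : ℝ) ≤ 1 / 2) (by norm_num)
    simp only [smul_eq_mul] at h
    rw [show (x + y) / 2 = 1 / 2 * x + 1 / 2 * y by ring]
    linarith
  have hm : (x + y + z) / 3 ∈ I := by
    have h1 : (x + y) / 2 ∈ I := by
      have h := hf.1 hx hy (by norm_num : (0 : ℝ) ≤ 1 / 2)
        (by norm_num : (0 : ℝ) ≤ 1 / 2) (by norm_num)
      simp only [smul_eq_mul] at h
      rwa [show (x + y) / 2 = 1 / 2 * x + 1 / 2 * y by ring]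
    have h := hf.1 h1 hz (by norm_num : (0 : ℝ) ≤ 2 / 3)
      (by norm_num : (0 : ℝ) ≤ 1 / 3) (by norm_num)
    simp only [smul_eq_mul] at h
    rwa [show (x + y + z) / 3 = 2 / 3 * ((x + y) / 2) + 1 / 3 * z by ring]
  set m := (x + y + z) / 3 with hm_def
  have hz_eq : z = 3 * m - x - y := by rw [hm_def]; ring
  obtain hD | hD := eq_or_ne ((x - m) + (y - m)) 0
  · have hxm : x = m := by nlinarith
    have hym : y = m := by linarith
    have hzm : z = m := by linarith
    rw [hxm, hym, hzm, add_self_div_two]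
    linarith
  · obtain ⟨r, hr0, hr1, hrx, hry⟩ : ∃ r : ℝ, 0 ≤ r ∧ r ≤ 1 / 2 ∧
        (x + z) / 2 = r * z + (1 - r) * m ∧
        (y + z) / 2 = (1 / 2 - r) * z + (1 / 2 + r) * m := by
      have key : ∀ a b : ℝ, 0 ≤ a * b → 0 ≤ b / (2 * (a + b)) := fun a b h ↦ by
        obtain ⟨ha, hb⟩ | ⟨ha, hb⟩ := mul_nonneg_iff.mp h
        · positivity
        · exact div_nonneg_of_nonpos hb (by linarith)
      have h1 := key _ _ hxy
      have h2 := key (y - m) (x - m) (by linarith)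
      have hsum : (y - m) / (2 * ((x - m) + (y - m))) +
          (x - m) / (2 * ((y - m) + (x - m))) = 1 / 2 := by
        rw [add_comm (y - m) (x - m)]
        field_simp
        ring
      refine ⟨(y - m) / (2 * ((x - m) + (y - m))), h1, by linarith, ?_, ?_⟩
      · rw [hz_eq]
        field_simp
        ring
      · rw [hz_eq]
        field_simp
        ring
    have h1 := hf.2 hz hm hr0 (by linarith : 0 ≤ 1 - r) (by ring)
    have h2 := hf.2 hz hm (by linarith : 0 ≤ 1 / 2 - r) (by linarith : 0 ≤ 1 / 2 + r) (by ring)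
    simp only [smul_eq_mul] at h1 h2
    rw [← hrx] at h1
    rw [← hry] at h2
    linarith


/-- Popoviciu's inequality for convex (`A_tA_t`-convex) positive functions. -/
theorem popoviciu_AA (I : Set ℝ) (hI : Convex ℝ I)
    (f : ℝ → ℝ) (hf_pos : ∀ x ∈ I, 0 < f x)
    (hf : ∀ x ∈ I, ∀ y ∈ I, ∀ t ∈ Set.Icc (0 : ℝ) 1,
      f (t * x + (1 - t) * y) ≤ t * f x + (1 - t) * f y) :
    ∀ x ∈ I, ∀ y ∈ I, ∀ z ∈ I,
      (2 / 3) * (f ((x + z) / 2) + f ((y + z) / 2) + f ((x + y) / 2)) ≤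
        f ((x + y + z) / 3) + (f x + f y + f z) / 3 := by
  intro x hx y hy z hz
  have hconv : ConvexOn ℝ I f := by
    refine ⟨hI, fun u hu v hv a b ha hb hab ↦ ?_⟩
    obtain rfl : b = 1 - a := by linarith
    exact hf u hu v hv a ⟨ha, by linarith⟩
  have hpair : ∀ a b c : ℝ, 0 ≤ a * b ∨ 0 ≤ b * c ∨ 0 ≤ a * c := fun a b c ↦ by
    by_contra! ⟨hab, hbc, hac⟩
    nlinarith [mul_pos_of_neg_of_neg hab hbc, sq_nonneg b]
  obtain h | h | h :=
    hpair (x - (x + y + z) / 3) (y - (x + y + z) / 3) (z - (x + y + z) / 3)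
  · exact hconv.popoviciu_of_same_side hx hy hz h
  · have e : y + z + x = x + y + z := by ring
    have := hconv.popoviciu_of_same_side hy hz hx (by rwa [e])
    rw [e, add_comm y x, add_comm z x] at this
    linarith
  · have e : x + z + y = x + y + z := by ring
    have := hconv.popoviciu_of_same_side hx hz hy (by rwa [e])
    rw [e, add_comm z y] at this
    linarith
end

section
/- Let I ⊆ ℝ be an interval and let f : I → (0,∞) satisfy f(t·x + (1−t)·y) ≥ f(x)·f(y) / ((1−t)·f(x) + t·f(y)) for all x,y ∈ I and t ∈ [0,1]. Then for all x, y, z ∈ I: (2/3)·(1/f((x+z)/2) + 1/f((y+z)/2) + 1/f((x+y)/2)) ≤ (1/3)·(1/f(x) + 1/f(y) + 1/f(z)) + 1/f((x+y+z)/3). -/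
/-- Popoviciu's inequality when the mean of the three points is `w + d` and both points other
than `w` lie on the far side of that mean from `w`. -/
theorem ConvexOn.popoviciu_of_parametrized {I : Set ℝ} {g : ℝ → ℝ} (hg : ConvexOn ℝ I g)
    {w d a : ℝ} (ha₁ : 1 ≤ a) (ha₂ : a ≤ 2) (hw : w ∈ I) (hx : w + a * d ∈ I)
    (hy : w + (3 - a) * d ∈ I) (hm : w + d ∈ I) :
    (2 / 3) * (g (w + a / 2 * d) + g (w + (3 - a) / 2 * d) + g (w + 3 / 2 * d)) ≤
      (1 / 3) * (g w + g (w + a * d) + g (w + (3 - a) * d)) + g (w + d) := by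
  have h₁ := hg.2 hw hm (show 0 ≤ 1 - a / 2 by linarith) (show 0 ≤ a / 2 by linarith) (by ring)
  have h₂ := hg.2 hw hm (show 0 ≤ 1 - (3 - a) / 2 by linarith)
    (show 0 ≤ (3 - a) / 2 by linarith) (by ring)
  have h₃ := hg.2 hx hy (show (0 : ℝ) ≤ 1 / 2 by norm_num) (show (0 : ℝ) ≤ 1 / 2 by norm_num)
    (by norm_num)
  simp only [smul_eq_mul] at h₁ h₂ h₃
  rw [show (1 - a / 2) * w + a / 2 * (w + d) = w + a / 2 * d by ring] at h₁
  rw [show (1 - (3 - a) / 2) * w + (3 - a) / 2 * (w + d) = w + (3 - a) / 2 * d by ring] at h₂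
  rw [show 1 / 2 * (w + a * d) + 1 / 2 * (w + (3 - a) * d) = w + 3 / 2 * d by ring] at h₃
  linarith

theorem ConvexOn.popoviciu_of_le {I : Set ℝ} {g : ℝ → ℝ} (hg : ConvexOn ℝ I g) {x y z : ℝ}
    (hx : x ∈ I) (hy : y ∈ I) (hz : z ∈ I) (hxy : x ≤ y) (hyz : y ≤ z) :
    (2 / 3) * (g ((x + z) / 2) + g ((y + z) / 2) + g ((x + y) / 2)) ≤
      (1 / 3) * (g x + g y + g z) + g ((x + y + z) / 3) := by
  have hm : (x + y + z) / 3 ∈ I := hg.1.ordConnected.out hx hz ⟨by linarith, by linarith⟩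
  rcases hxy.trans hyz |>.eq_or_lt with hxz | hxz
  · obtain rfl : x = y := by linarith
    subst hxz
    rw [show (x + x) / 2 = x by ring, show (x + x + x) / 3 = x by ring]
    linarith
  rcases le_total y ((x + y + z) / 3) with h | h
  · obtain ⟨d, hd⟩ : ∃ d, d = (x + y + z) / 3 - z := ⟨_, rfl⟩
    have hd₀ : d < 0 := by linarith
    obtain ⟨a, rfl⟩ : ∃ a, y = z + a * d := ⟨(y - z) / d, by field_simp [hd₀.ne]; ring⟩
    obtain rfl : x = z + (3 - a) * d := by linarith
    have key := hg.popoviciu_of_parametrized (w := z) (d := d) (a := a)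
      (by nlinarith) (by nlinarith) hz hy hx (by convert hm using 1; ring)
    convert key using 1 <;> ring_nf
  · obtain ⟨d, hd⟩ : ∃ d, d = (x + y + z) / 3 - x := ⟨_, rfl⟩
    have hd₀ : 0 < d := by linarith
    obtain ⟨a, rfl⟩ : ∃ a, y = x + a * d := ⟨(y - x) / d, by field_simp [hd₀.ne']; ring⟩
    obtain rfl : z = x + (3 - a) * d := by linarith
    have key := hg.popoviciu_of_parametrized (w := x) (d := d) (a := a)
      (by nlinarith) (by nlinarith) hx hy hz (by convert hm using 1; ring)
    convert key using 1 <;> ring_nf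

/-- **Popoviciu's inequality** for convex functions. -/
theorem ConvexOn.popoviciu {I : Set ℝ} {g : ℝ → ℝ} (hg : ConvexOn ℝ I g) {x y z : ℝ}
    (hx : x ∈ I) (hy : y ∈ I) (hz : z ∈ I) :
    (2 / 3) * (g ((x + z) / 2) + g ((y + z) / 2) + g ((x + y) / 2)) ≤
      (1 / 3) * (g x + g y + g z) + g ((x + y + z) / 3) := by
  rcases le_total x y with h₁ | h₁ <;> rcases le_total y z with h₂ | h₂ <;>
    rcases le_total x z with h₃ | h₃
  · exact hg.popoviciu_of_le hx hy hz h₁ h₂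
  · exact hg.popoviciu_of_le hx hy hz h₁ h₂
  · convert hg.popoviciu_of_le hx hz hy h₃ h₂ using 1 <;> ring_nf
  · convert hg.popoviciu_of_le hz hx hy h₃ h₁ using 1 <;> ring_nf
  · convert hg.popoviciu_of_le hy hx hz h₁ h₃ using 1 <;> ring_nf
  · convert hg.popoviciu_of_le hy hz hx h₂ h₃ using 1 <;> ring_nf
  · convert hg.popoviciu_of_le hz hy hx h₂ h₁ using 1 <;> ring_nf
  · convert hg.popoviciu_of_le hz hy hx h₂ h₁ using 1 <;> ring_nf

/-- The reciprocal of an `A_tH_t`-concave function is convex. -/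
theorem convexOn_one_div_of_AH {I : Set ℝ} (hI : Convex ℝ I) {f : ℝ → ℝ}
    (hf_pos : ∀ x ∈ I, 0 < f x)
    (hf : ∀ x ∈ I, ∀ y ∈ I, ∀ t ∈ Set.Icc (0 : ℝ) 1,
      f (t * x + (1 - t) * y) ≥ f x * f y / ((1 - t) * f x + t * f y)) :
    ConvexOn ℝ I fun x ↦ 1 / f x := by
  refine ⟨hI, fun x hx y hy a b ha hb hab ↦ ?_⟩
  obtain rfl : b = 1 - a := by linarith
  have hfx := hf_pos x hx
  have hfy := hf_pos y hy
  have hden : 0 < (1 - a) * f x + a * f y := by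
    rcases ha.eq_or_lt with rfl | ha
    · simpa using hfx
    · have := mul_pos ha hfy
      have := mul_nonneg hb hfx.le
      linarith
  have h := one_div_le_one_div_of_le (by positivity) (hf x hx y hy a ⟨ha, by linarith⟩)
  simp only [smul_eq_mul]
  refine h.trans_eq ?_
  field_simp
  ring

/-- Popoviciu-type inequality for `A_tH_t`-concave functions. -/
theorem popoviciu_AH (I : Set ℝ) (hI : Convex ℝ I)
    (f : ℝ → ℝ) (hf_pos : ∀ x ∈ I, 0 < f x)
    (hf : ∀ x ∈ I, ∀ y ∈ I, ∀ t ∈ Set.Icc (0 : ℝ) 1,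
      f (t * x + (1 - t) * y) ≥ f x * f y / ((1 - t) * f x + t * f y)) :
    ∀ x ∈ I, ∀ y ∈ I, ∀ z ∈ I,
      (2 / 3) * (1 / f ((x + z) / 2) + 1 / f ((y + z) / 2) + 1 / f ((x + y) / 2)) ≤
        (1 / 3) * (1 / f x + 1 / f y + 1 / f z) + 1 / f ((x + y + z) / 3) := by
  intro x hx y hy z hz
  exact (convexOn_one_div_of_AH hI hf_pos hf).popoviciu hx hy hz
end

section
/- Let I ⊆ (0,∞) be an interval, let h : [0,∞) → [0,∞) be superadditive (h(s+t) ≥ h(s) + h(t) for all s,t ≥ 0), and let f : I → (0,∞) satisfy f(x^t · y^{1−t}) ≤ h(t)·f(x) + h(1−t)·f(y) for all x,y ∈ I and t ∈ [0,1]. Then for all x, y, z ∈ I: f(√(xz)) + f(√(yz)) + f(√(xy)) ≤ h(3/2)·f((xyz)^{1/3}) + h(1/2)·(f(x) + f(y) + f(z)). -/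
/-- Two reals `u`, `v` on the same side of the mean of `u, v, w`: the midpoints of `w` with `u` and
with `v` are convex combinations of the mean and `w`, whose weights at the mean add up to `3 / 2`. -/
theorem exists_weights_of_same_side {u v w m : ℝ} (hm : 3 * m = u + v + w)
    (huv : (0 ≤ u - m ∧ 0 ≤ v - m) ∨ (u - m ≤ 0 ∧ v - m ≤ 0)) :
    ∃ s ∈ Set.Icc (0 : ℝ) 1, ∃ t ∈ Set.Icc (0 : ℝ) 1, s + t = 3 / 2 ∧
      s * m + (1 - s) * w = (u + w) / 2 ∧ t * m + (1 - t) * w = (v + w) / 2 := by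
  by_cases hw : w - m = 0
  · have hu : u = m := by rcases huv with ⟨_, _⟩ | ⟨_, _⟩ <;> linarith
    have hv : v = m := by linarith
    have hw' : w = m := by linarith
    subst hu hv hw'
    exact ⟨3 / 4, by norm_num, 3 / 4, by norm_num, by norm_num, by ring, by ring⟩
  · have weight_mem : ∀ a b : ℝ, 3 * m = a + b + w →
        ((0 ≤ a - m ∧ 0 ≤ b - m) ∨ (a - m ≤ 0 ∧ b - m ≤ 0)) →
        (w - a) / (2 * (w - m)) ∈ Set.Icc (0 : ℝ) 1 := by
      rintro a b hab (⟨ha, hb⟩ | ⟨ha, hb⟩)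
      · have hneg : w - m < 0 := lt_of_le_of_ne (by linarith) hw
        exact ⟨div_nonneg_of_nonpos (by linarith) (by linarith),
          (div_le_one_of_neg (by linarith)).2 (by linarith)⟩
      · have hpos : 0 < w - m := lt_of_le_of_ne (by linarith) (Ne.symm hw)
        exact ⟨div_nonneg (by linarith) (by linarith),
          (div_le_one (by linarith)).2 (by linarith)⟩
    refine ⟨(w - u) / (2 * (w - m)), weight_mem u v hm huv,
      (w - v) / (2 * (w - m)), weight_mem v u (by linarith) (by tauto), ?_, ?_, ?_⟩
    · field_simp
      linarith
    · field_simp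
      ring
    · field_simp
      ring

/-- Popoviciu's inequality for `h`-convex functions, `h` superadditive, when two of the points lie
on the same side of the mean. -/
theorem popoviciu_of_same_side_s7 {J : Set ℝ} {h F : ℝ → ℝ}
    (hh_super : ∀ s, 0 ≤ s → ∀ t, 0 ≤ t → h s + h t ≤ h (s + t))
    (hF_nonneg : ∀ x ∈ J, 0 ≤ F x)
    (hF : ∀ x ∈ J, ∀ y ∈ J, ∀ t ∈ Set.Icc (0 : ℝ) 1,
      F (t * x + (1 - t) * y) ≤ h t * F x + h (1 - t) * F y)
    {u v w m : ℝ} (hu : u ∈ J) (hv : v ∈ J) (hw : w ∈ J) (hmJ : m ∈ J)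
    (hm : 3 * m = u + v + w)
    (huv : (0 ≤ u - m ∧ 0 ≤ v - m) ∨ (u - m ≤ 0 ∧ v - m ≤ 0)) :
    F ((u + w) / 2) + F ((v + w) / 2) + F ((u + v) / 2) ≤
      h (3 / 2) * F m + h (1 / 2) * (F u + F v + F w) := by
  obtain ⟨s, hs, t, ht, hst, hsu, htv⟩ := exists_weights_of_same_side hm huv
  have h1 := hF m hmJ w hw s hs
  have h2 := hF m hmJ w hw t ht
  have h3 := hF u hu v hv (1 / 2) (by norm_num)
  rw [hsu] at h1
  rw [htv] at h2
  rw [show (1 / 2 : ℝ) * u + (1 - 1 / 2) * v = (u + v) / 2 by ring,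
    show (1 : ℝ) - 1 / 2 = 1 / 2 by norm_num] at h3
  have h4 := hh_super s hs.1 t ht.1
  have h5 := hh_super (1 - s) (by linarith [hs.2]) (1 - t) (by linarith [ht.2])
  rw [hst] at h4
  rw [show 1 - s + (1 - t) = 1 / 2 by linarith] at h5
  have h6 := mul_le_mul_of_nonneg_right h4 (hF_nonneg m hmJ)
  have h7 := mul_le_mul_of_nonneg_right h5 (hF_nonneg w hw)
  linarith

/-- Popoviciu's inequality for `h`-convex functions with superadditive `h`. -/
theorem popoviciu_of_superadditive {J : Set ℝ} (hJ : Convex ℝ J) {h F : ℝ → ℝ}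
    (hh_super : ∀ s, 0 ≤ s → ∀ t, 0 ≤ t → h s + h t ≤ h (s + t))
    (hF_nonneg : ∀ x ∈ J, 0 ≤ F x)
    (hF : ∀ x ∈ J, ∀ y ∈ J, ∀ t ∈ Set.Icc (0 : ℝ) 1,
      F (t * x + (1 - t) * y) ≤ h t * F x + h (1 - t) * F y)
    {u v w : ℝ} (hu : u ∈ J) (hv : v ∈ J) (hw : w ∈ J) :
    F ((u + w) / 2) + F ((v + w) / 2) + F ((u + v) / 2) ≤
      h (3 / 2) * F ((u + v + w) / 3) + h (1 / 2) * (F u + F v + F w) := by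
  have hmid : (u + v) / 2 ∈ J := by
    convert hJ hu hv (a := 1 / 2) (b := 1 / 2) (by norm_num) (by norm_num) (by norm_num) using 1
    simp only [smul_eq_mul]
    ring
  have hmJ : (u + v + w) / 3 ∈ J := by
    convert hJ hmid hw (a := 2 / 3) (b := 1 / 3) (by norm_num) (by norm_num) (by norm_num) using 1
    simp only [smul_eq_mul]
    ring
  have key := fun {a b c : ℝ} (ha : a ∈ J) (hb : b ∈ J) (hc : c ∈ J) =>
    popoviciu_of_same_side_s7 hh_super hF_nonneg hF ha hb hc hmJ
  set m := (u + v + w) / 3 with hm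
  have hsides : ((0 ≤ u - m ∧ 0 ≤ v - m) ∨ (u - m ≤ 0 ∧ v - m ≤ 0)) ∨
      ((0 ≤ u - m ∧ 0 ≤ w - m) ∨ (u - m ≤ 0 ∧ w - m ≤ 0)) ∨
      ((0 ≤ v - m ∧ 0 ≤ w - m) ∨ (v - m ≤ 0 ∧ w - m ≤ 0)) := by
    have hu' := le_total 0 (u - m)
    have hv' := le_total 0 (v - m)
    have hw' := le_total 0 (w - m)
    tauto
  rcases hsides with hs | hs | hs
  · exact key hu hv hw (by linarith) hs
  · have := key hu hw hv (by linarith) hs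
    rw [add_comm w v] at this
    linarith
  · have := key hv hw hu (by linarith) hs
    rw [add_comm v u, add_comm w u] at this
    linarith

/-- Popoviciu-type inequality for `G_tA_h`-convex functions with superadditive `h`. -/
theorem popoviciu_GA_h (I : Set ℝ) (hI : Convex ℝ I) (hI_pos : I ⊆ Set.Ioi (0 : ℝ))
    (h : ℝ → ℝ) (hh_nonneg : ∀ s, 0 ≤ s → 0 ≤ h s)
    (hh_super : ∀ s, 0 ≤ s → ∀ t, 0 ≤ t → h s + h t ≤ h (s + t))
    (f : ℝ → ℝ) (hf_pos : ∀ x ∈ I, 0 < f x)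
    (hf : ∀ x ∈ I, ∀ y ∈ I, ∀ t ∈ Set.Icc (0 : ℝ) 1,
      f (x ^ t * y ^ (1 - t)) ≤ h t * f x + h (1 - t) * f y) :
    ∀ x ∈ I, ∀ y ∈ I, ∀ z ∈ I,
      f (Real.sqrt (x * z)) + f (Real.sqrt (y * z)) + f (Real.sqrt (x * y)) ≤
        h (3 / 2) * f ((x * y * z) ^ ((1 : ℝ) / 3)) + h (1 / 2) * (f x + f y + f z) := by
  intro x hx y hy z hz
  have exp_log_of_mem : ∀ a ∈ I, Real.exp (Real.log a) = a := fun a ha =>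
    Real.exp_log (hI_pos ha)
  have sqrt_eq : ∀ a ∈ I, ∀ b ∈ I,
      Real.sqrt (a * b) = Real.exp ((Real.log a + Real.log b) / 2) := by
    intro a ha b hb
    rw [Real.exp_half, Real.exp_add, exp_log_of_mem a ha, exp_log_of_mem b hb]
  have cbrt_eq : (x * y * z) ^ ((1 : ℝ) / 3) =
      Real.exp ((Real.log x + Real.log y + Real.log z) / 3) := by
    have hx0 : 0 < x := hI_pos hx
    have hy0 : 0 < y := hI_pos hy
    have hz0 : 0 < z := hI_pos hz
    rw [Real.rpow_def_of_pos (by positivity), Real.log_mul (by positivity) hz0.ne',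
      Real.log_mul hx0.ne' hy0.ne']
    congr 1
    ring
  have hJ : Convex ℝ (Real.exp ⁻¹' I) :=
    (hI.ordConnected.preimage_mono Real.exp_monotone).convex
  have hmem : ∀ a ∈ I, Real.log a ∈ Real.exp ⁻¹' I := fun a ha => by
    rwa [Set.mem_preimage, exp_log_of_mem a ha]
  have main := popoviciu_of_superadditive (F := fun u => f (Real.exp u)) hJ hh_super
    (fun u hu => (hf_pos _ hu).le)
    (fun u hu v hv t ht => by
      have huv := hf _ hu _ hv t ht
      rwa [← Real.exp_mul, ← Real.exp_mul, ← Real.exp_add, mul_comm u, mul_comm v] at huv)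
    (hmem x hx) (hmem y hy) (hmem z hz)
  simp only [exp_log_of_mem x hx, exp_log_of_mem y hy, exp_log_of_mem z hz] at main
  rwa [sqrt_eq x hx z hz, sqrt_eq y hy z hz, sqrt_eq x hx y hy, cbrt_eq]
end

section
/- Let I ⊆ (0,∞) be an interval and let f : I → (0,∞) satisfy f(x^t · y^{1−t}) ≤ t·f(x) + (1−t)·f(y) for all x,y ∈ I and t ∈ [0,1]. Then for all x, y, z ∈ I: (2/3)·(f(√(xz)) + f(√(yz)) + f(√(xy))) ≤ f((xyz)^{1/3}) + (f(x) + f(y) + f(z))/3. -/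
/-- Popoviciu's inequality when two of the points lie on the same side of the mean. -/
theorem ConvexOn.popoviciu_of_same_side_s8 {s : Set ℝ} {g : ℝ → ℝ} (hg : ConvexOn ℝ s g)
    {a b c m : ℝ} (ha : a ∈ s) (hb : b ∈ s) (hc : c ∈ s) (hm : m ∈ s)
    (hmean : a + b + c = 3 * m) (hside : (a ≤ m ∧ b ≤ m) ∨ (m ≤ a ∧ m ≤ b)) :
    2 * (g ((a + c) / 2) + g ((b + c) / 2) + g ((a + b) / 2)) ≤
      3 * g m + (g a + g b + g c) := by
  obtain ⟨t, ht0, ht1, ht⟩ : ∃ t : ℝ, 0 ≤ t ∧ t ≤ 1 / 2 ∧ m - b = 2 * t * (c - m) := by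
    rcases eq_or_ne c m with h | h
    · refine ⟨0, le_rfl, by norm_num, ?_⟩
      rcases hside with ⟨_, _⟩ | ⟨_, _⟩ <;> linarith
    · have hcm : c - m ≠ 0 := sub_ne_zero.mpr h
      refine ⟨(m - b) / (2 * (c - m)), ?_, ?_, by field_simp⟩
      · rcases hside with ⟨_, _⟩ | ⟨_, _⟩
        · exact div_nonneg (by linarith) (by linarith)
        · exact div_nonneg_of_nonpos (by linarith) (by linarith)
      · rcases hside with ⟨_, _⟩ | ⟨_, _⟩
        · have : 0 < c - m := lt_of_le_of_ne (by linarith) hcm.symm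
          rw [div_le_iff₀ (by linarith)]
          linarith
        · have : c - m < 0 := lt_of_le_of_ne (by linarith) hcm
          rw [div_le_iff_of_neg (by linarith)]
          linarith
  have hac := hg.2 hc hm ht0 (show 0 ≤ 1 - t by linarith) (by ring)
  have hbc := hg.2 hc hm (show 0 ≤ 1 / 2 - t by linarith)
    (show 0 ≤ 1 / 2 + t by linarith) (by ring)
  have hab := hg.2 ha hb (show (0 : ℝ) ≤ 1 / 2 by norm_num)
    (show (0 : ℝ) ≤ 1 / 2 by norm_num) (by norm_num)
  simp only [smul_eq_mul] at hac hbc hab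
  rw [show t * c + (1 - t) * m = (a + c) / 2 by linarith] at hac
  rw [show (1 / 2 - t) * c + (1 / 2 + t) * m = (b + c) / 2 by linarith] at hbc
  rw [show 1 / 2 * a + 1 / 2 * b = (a + b) / 2 by ring] at hab
  linarith

/-- Popoviciu's inequality for convex functions on a subset of the real line. -/
theorem ConvexOn.popoviciu_s8 {s : Set ℝ} {g : ℝ → ℝ} (hg : ConvexOn ℝ s g)
    {a b c : ℝ} (ha : a ∈ s) (hb : b ∈ s) (hc : c ∈ s) :
    2 * (g ((a + c) / 2) + g ((b + c) / 2) + g ((a + b) / 2)) ≤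
      3 * g ((a + b + c) / 3) + (g a + g b + g c) := by
  obtain ⟨m, hm⟩ : ∃ m, m = (a + b + c) / 3 := ⟨_, rfl⟩
  have hms : m ∈ s := by
    have hmid := hg.1 ha hb (show (0 : ℝ) ≤ 1 / 2 by norm_num)
      (show (0 : ℝ) ≤ 1 / 2 by norm_num) (by norm_num)
    have := hg.1 hmid hc (show (0 : ℝ) ≤ 2 / 3 by norm_num)
      (show (0 : ℝ) ≤ 1 / 3 by norm_num) (by norm_num)
    simp only [smul_eq_mul] at this
    convert this using 1
    rw [hm]
    ring
  rw [← hm]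
  have hc_case := hg.popoviciu_of_same_side_s8 ha hb hc hms (by linarith)
  have hb_case := hg.popoviciu_of_same_side_s8 ha hc hb hms (by linarith)
  have ha_case := hg.popoviciu_of_same_side_s8 hb hc ha hms (by linarith)
  rw [add_comm c b] at hb_case
  rw [add_comm b a, add_comm c a] at ha_case
  rcases le_total a m with h₁ | h₁ <;> rcases le_total b m with h₂ | h₂ <;>
    rcases le_total c m with h₃ | h₃ <;>
    simp only [h₁, h₂, h₃, and_self, true_or, or_true, forall_const] at hc_case hb_case ha_case <;>
    linarith

/-- A function satisfying the geometric-arithmetic convexity inequality on an interval becomes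
convex after the substitution `x = exp u`. -/
theorem convexOn_comp_exp {I : Set ℝ} (hI : Convex ℝ I) {f : ℝ → ℝ}
    (hf : ∀ x ∈ I, ∀ y ∈ I, ∀ t ∈ Set.Icc (0 : ℝ) 1,
      f (x ^ t * y ^ (1 - t)) ≤ t * f x + (1 - t) * f y) :
    ConvexOn ℝ (Real.exp ⁻¹' I) (f ∘ Real.exp) := by
  refine ⟨(hI.ordConnected.preimage_mono Real.exp_monotone).convex, ?_⟩
  intro u hu v hv p q hp hq hpq
  obtain rfl : q = 1 - p := by linarith
  have h := hf _ hu _ hv p ⟨hp, by linarith⟩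
  rw [← Real.exp_mul, ← Real.exp_mul, ← Real.exp_add, mul_comm u, mul_comm v] at h
  simpa using h

/-- Popoviciu-type inequality for `G_tA_t`-convex functions. -/
theorem popoviciu_GA (I : Set ℝ) (hI : Convex ℝ I) (hI_pos : I ⊆ Set.Ioi (0 : ℝ))
    (f : ℝ → ℝ) (hf_pos : ∀ x ∈ I, 0 < f x)
    (hf : ∀ x ∈ I, ∀ y ∈ I, ∀ t ∈ Set.Icc (0 : ℝ) 1,
      f (x ^ t * y ^ (1 - t)) ≤ t * f x + (1 - t) * f y) :
    ∀ x ∈ I, ∀ y ∈ I, ∀ z ∈ I,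
      (2 / 3) * (f (Real.sqrt (x * z)) + f (Real.sqrt (y * z)) + f (Real.sqrt (x * y))) ≤
        f ((x * y * z) ^ ((1 : ℝ) / 3)) + (f x + f y + f z) / 3 := by
  intro x hx y hy z hz
  obtain ⟨a, rfl⟩ : ∃ a, Real.exp a = x := ⟨_, Real.exp_log (hI_pos hx)⟩
  obtain ⟨b, rfl⟩ : ∃ b, Real.exp b = y := ⟨_, Real.exp_log (hI_pos hy)⟩
  obtain ⟨c, rfl⟩ : ∃ c, Real.exp c = z := ⟨_, Real.exp_log (hI_pos hz)⟩
  have h := (convexOn_comp_exp hI hf).popoviciu_s8 (a := a) (b := b) (c := c) hx hy hz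
  simp only [Function.comp_apply, Real.exp_half] at h
  simp only [← Real.exp_add, ← Real.exp_mul, mul_one_div]
  linarith
end
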